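/- (Non-compliance of two retractable sums when all matching branches fail.) If ρ = Σ_{i∈I} α_i.ρ_i and σ = Σ_{j∈J} ᾱ_j.σ_j are retractable choices such that for every k ∈ I ∩ J the continuations are not compliant (ρ_k ⫤ σ_k fails), then ρ is not compliant with σ: there is a reduction from ⟨[]⟩ρ ∥ ⟨[]⟩σ, successively trying and rolling back each matching branch, ending in the stuck configuration ⟨[]⟩Σ_{i∈I\J} α_i.ρ_i ∥ ⟨[]⟩Σ_{j∈J\I} ᾱ_j.σ_j whose client is different from 1. -/

import Mathlib

/-! Retractable contracts (Barbanera, Dezani-Ciancaglini, Lanese, de'Liguoro,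
"Retractable Contracts"). -/

/-- Retractable contract expressions, with de Bruijn indices for recursion.
`ext true l` is a retractable input sum `Σ aᵢ.σᵢ`, `ext false l` a retractable
output sum `Σ āᵢ.σᵢ`, and `intSum l` an unretractable output choice `⊕ āᵢ.σᵢ`. -/
inductive RC : Type
  | one : RC
  | ext : Bool → List (ℕ × RC) → RC
  | intSum : List (ℕ × RC) → RC
  | var : ℕ → RC
  | mu : RC → RC

namespace RC

/-- Substitution of the (closed) term `u` for variable `k`. -/
def subst (t : RC) (k : ℕ) (u : RC) : RC :=
  match t with
  | .one => .one
  | .var n => if n = k then u else .var n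
  | .mu σ => .mu (subst σ (k+1) u)
  | .ext p l => .ext p (l.attach.map fun x => (x.1.1, subst x.1.2 k u))
  | .intSum l => .intSum (l.attach.map fun x => (x.1.1, subst x.1.2 k u))
termination_by sizeOf t
decreasing_by
  all_goals simp_wf
  all_goals first
    | omega
    | (obtain ⟨⟨a, s⟩, hx⟩ := x
       have h := List.sizeOf_lt_of_mem hx
       simp [Prod.mk.sizeOf_spec] at h ⊢
       omega)

/-- One-step unfolding of the recursive contract `mu σ`
(`rec x.σ` is equated with `σ[rec x.σ / x]`). -/
def unf (σ : RC) : RC := subst σ 0 (.mu σ)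

/-- Well-formedness: `WFa n σ` means all free variables of `σ` are below `n`,
all sums are non-empty with pairwise distinct names, and recursion is guarded
(the body of a recursion is not a variable). -/
inductive WFa : ℕ → RC → Prop
  | one : ∀ n, WFa n .one
  | var : ∀ n m, m < n → WFa n (.var m)
  | ext : ∀ (n : ℕ) (p : Bool) (l : List (ℕ × RC)), l ≠ [] → (l.map Prod.fst).Nodup →
      (∀ x ∈ l, WFa n x.2) → WFa n (.ext p l)
  | intSum : ∀ (n : ℕ) (l : List (ℕ × RC)), l ≠ [] → (l.map Prod.fst).Nodup →
      (∀ x ∈ l, WFa n x.2) → WFa n (.intSum l)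
  | mu : ∀ (n : ℕ) (σ : RC), (∀ m, σ ≠ .var m) → WFa (n+1) σ → WFa n (.mu σ)

end RC

/-- A retractable contract: a closed well-formed expression. -/
def WF (σ : RC) : Prop := RC.WFa 0 σ

/-- Head unfolding: `Unf ρ τ` holds when repeatedly unfolding top-level
recursion in `ρ` yields `τ` (equi-recursive view of recursion). -/
inductive Unf : RC → RC → Prop
  | one : Unf .one .one
  | ext : ∀ p l, Unf (.ext p l) (.ext p l)
  | intSum : ∀ l, Unf (.intSum l) (.intSum l)
  | var : ∀ n, Unf (.var n) (.var n)
  | mu : ∀ σ τ, Unf (RC.unf σ) τ → Unf (.mu σ) τ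

/-- Actions of the LTS: `act true a` is the input `a`, `act false a` is the
output `ā`; `tau` is the internal action; `rb` is rollback. -/
inductive Act : Type
  | act : Bool → ℕ → Act
  | tau : Act
  | rb : Act

/-- Histories (stacks); the head of the list is the top of the stack.
`none` is the placeholder `∘` (no remaining alternatives). -/
abbrev Hist := List (Option RC)

/-- The sum of the remaining branches of a retractable sum, or `∘` if no
branch remains. -/
def restOf (p : Bool) (l : List (ℕ × RC)) : Option RC :=
  match l with
  | [] => none
  | _ => some (.ext p l)

/-- LTS of contracts with histories: rules (+)/(α) (`ext`, `intOut`), (⊕)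
(`intTau`), (rb) (`rb`), plus transparent unfolding of recursion (`mu`). -/
inductive Step : Hist → Option RC → Act → Hist → Option RC → Prop
  | ext : ∀ (γ : Hist) (p : Bool) (l₁ l₂ : List (ℕ × RC)) (a : ℕ) (σ : RC),
      Step γ (some (.ext p (l₁ ++ (a, σ) :: l₂))) (.act p a)
        (restOf p (l₁ ++ l₂) :: γ) (some σ)
  | intTau : ∀ (γ : Hist) (l : List (ℕ × RC)) (a : ℕ) (σ : RC),
      (a, σ) ∈ l → 2 ≤ l.length →
      Step γ (some (.intSum l)) .tau γ (some (.intSum [(a, σ)]))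
  | intOut : ∀ (γ : Hist) (a : ℕ) (σ : RC),
      Step γ (some (.intSum [(a, σ)])) (.act false a) (none :: γ) (some σ)
  | rb : ∀ (γ : Hist) (σ' ρ : Option RC),
      Step (σ' :: γ) ρ .rb γ σ'
  | mu : ∀ (γ : Hist) (σ : RC) (α : Act) (δ : Hist) (ρ : Option RC),
      Step γ (some (RC.unf σ)) α δ ρ → Step γ (some (.mu σ)) α δ ρ

/-- Client/server configurations `⟨cH⟩c ∥ ⟨sH⟩s`. -/
structure Conf : Type where
  cH : Hist
  c  : Option RC
  sH : Hist
  s  : Option RC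

/-- Forward reduction of client/server pairs: rules (comm) and (τ). -/
inductive FRed : Conf → Conf → Prop
  | comm : ∀ (δ δ' γ γ' : Hist) (ρ ρ' σ σ' : Option RC) (p : Bool) (a : ℕ),
      Step δ ρ (.act p a) δ' ρ' → Step γ σ (.act (!p) a) γ' σ' →
      FRed ⟨δ, ρ, γ, σ⟩ ⟨δ', ρ', γ', σ'⟩
  | tauL : ∀ (δ δ' γ : Hist) (ρ ρ' σ : Option RC),
      Step δ ρ .tau δ' ρ' → FRed ⟨δ, ρ, γ, σ⟩ ⟨δ', ρ', γ, σ⟩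
  | tauR : ∀ (δ γ γ' : Hist) (ρ σ σ' : Option RC),
      Step γ σ .tau γ' σ' → FRed ⟨δ, ρ, γ, σ⟩ ⟨δ, ρ, γ', σ'⟩

/-- Reduction of client/server pairs: forward steps, plus the rule (rbk),
applicable only when the client is not `1` and no forward step is possible. -/
inductive Red : Conf → Conf → Prop
  | fwd : ∀ c c', FRed c c' → Red c c'
  | rbk : ∀ (δ δ' γ γ' : Hist) (ρ ρ' σ σ' : Option RC),
      ρ ≠ some .one → (∀ d, ¬ FRed ⟨δ, ρ, γ, σ⟩ d) →
      Step δ ρ .rb δ' ρ' → Step γ σ .rb γ' σ' →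
      Red ⟨δ, ρ, γ, σ⟩ ⟨δ', ρ', γ', σ'⟩

/-- Multi-step reduction of client/server pairs. -/
def Reds : Conf → Conf → Prop := Relation.ReflTransGen Red

/-- A configuration admitting no reduction. -/
def Stuck (c : Conf) : Prop := ∀ c', ¬ Red c c'

/-- A rollback step of a client/server pair (an instance of rule (rbk)). -/
def RbkStep (c c' : Conf) : Prop :=
  c.c ≠ some RC.one ∧ (∀ d, ¬ FRed c d) ∧
  Step c.cH c.c .rb c'.cH c'.c ∧ Step c.sH c.s .rb c'.sH c'.s

/-- Compliance of contracts with histories: every reachable stuck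
configuration has client `1`. -/
def CompliantCH (δ : Hist) (ρ : Option RC) (γ : Hist) (σ : Option RC) : Prop :=
  ∀ c' : Conf, Reds ⟨δ, ρ, γ, σ⟩ c' → Stuck c' → c'.c = some RC.one

/-- Compliance of contracts: `ρ ⫤ σ`. -/
def Compliant (ρ σ : RC) : Prop := CompliantCH [] (some ρ) [] (some σ)

/-- The formal system for compliance: `Derives Γ ρ σ` is the judgment
`Γ ▷ ρ ⊣ σ`, with rules (Ax), (Hyp), (+,+), (⊕,+), (+,⊕), and rules
realising the equi-recursive identification `rec x.σ = σ[rec x.σ/x]`. -/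
inductive Derives : List (RC × RC) → RC → RC → Prop
  | ax : ∀ Γ σ, Derives Γ .one σ
  | hyp : ∀ Γ ρ σ, (ρ, σ) ∈ Γ → Derives Γ ρ σ
  | plusPlus : ∀ (Γ : List (RC × RC)) (p : Bool) (lρ lσ : List (ℕ × RC)) (a : ℕ) (ρk σk : RC),
      (a, ρk) ∈ lρ → (a, σk) ∈ lσ →
      Derives ((RC.ext p lρ, RC.ext (!p) lσ) :: Γ) ρk σk →
      Derives Γ (.ext p lρ) (.ext (!p) lσ)
  | oplusPlus : ∀ (Γ : List (RC × RC)) (lρ lσ : List (ℕ × RC)),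
      (∀ x ∈ lρ, x.1 ∈ lσ.map Prod.fst) →
      (∀ (a : ℕ) (ρi σi : RC), (a, ρi) ∈ lρ → (a, σi) ∈ lσ →
        Derives ((RC.intSum lρ, RC.ext true lσ) :: Γ) ρi σi) →
      Derives Γ (.intSum lρ) (.ext true lσ)
  | plusOplus : ∀ (Γ : List (RC × RC)) (lρ lσ : List (ℕ × RC)),
      (∀ x ∈ lσ, x.1 ∈ lρ.map Prod.fst) →
      (∀ (a : ℕ) (ρj σj : RC), (a, ρj) ∈ lρ → (a, σj) ∈ lσ →
        Derives ((RC.ext true lρ, RC.intSum lσ) :: Γ) ρj σj) →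
      Derives Γ (.ext true lρ) (.intSum lσ)
  | unfoldL : ∀ (Γ : List (RC × RC)) (σ τ : RC),
      Derives Γ (RC.unf σ) τ → Derives Γ (.mu σ) τ
  | unfoldR : ∀ (Γ : List (RC × RC)) (ρ σ : RC),
      Derives Γ ρ (RC.unf σ) → Derives Γ ρ (.mu σ)

theorem Step.append {γ δ : Hist} {ρ ρ' : Option RC} {α : Act}
    (hs : Step γ ρ α δ ρ') (H : Hist) : Step (γ ++ H) ρ α (δ ++ H) ρ' := by
  induction hs with
  | ext γ p l₁ l₂ a σ => exact .ext _ p l₁ l₂ a σ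
  | intTau γ l a σ hm hl => exact .intTau _ l a σ hm hl
  | intOut γ a σ => exact .intOut _ a σ
  | rb γ σ' ρ => exact .rb _ σ' ρ
  | mu γ σ α δ ρ _ ih => exact .mu _ σ α _ ρ ih

/-- Forward steps do not depend on the history. -/
theorem Step.change_hist {γ δ : Hist} {ρ ρ' : Option RC} {α : Act}
    (hs : Step γ ρ α δ ρ') (hα : α ≠ .rb) (H : Hist) : ∃ δ', Step H ρ α δ' ρ' := by
  induction hs with
  | ext γ p l₁ l₂ a σ => exact ⟨_, .ext _ p l₁ l₂ a σ⟩
  | intTau γ l a σ hm hl => exact ⟨_, .intTau _ l a σ hm hl⟩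
  | intOut γ a σ => exact ⟨_, .intOut _ a σ⟩
  | rb γ σ' ρ => exact absurd rfl hα
  | mu γ σ α δ ρ _ ih =>
    obtain ⟨δ', hδ⟩ := ih hα
    exact ⟨δ', .mu _ σ α _ ρ hδ⟩

theorem Step.length_hist {γ δ : Hist} {ρ ρ' : Option RC} {α : Act} (hs : Step γ ρ α δ ρ') :
    (∀ p a, α = .act p a → δ.length = γ.length + 1) ∧ (α = .tau → δ.length = γ.length) ∧
      (α = .rb → γ.length = δ.length + 1) := by
  induction hs with
  | mu γ σ α δ ρ _ ih => exact ih
  | _ => simp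

/-- The configuration with the histories `H` and `K` put below its own ones. -/
def Conf.addHist (c : Conf) (H K : Hist) : Conf := ⟨c.cH ++ H, c.c, c.sH ++ K, c.s⟩

theorem FRed.addHist {c c' : Conf} (hr : FRed c c') (H K : Hist) :
    FRed (c.addHist H K) (c'.addHist H K) := by
  cases hr with
  | comm δ δ' γ γ' ρ ρ' σ σ' p a h₁ h₂ =>
    exact .comm _ _ _ _ _ _ _ _ p a (h₁.append H) (h₂.append K)
  | tauL δ δ' γ ρ ρ' σ h₁ => exact .tauL _ _ _ _ _ _ (h₁.append H)
  | tauR δ γ γ' ρ σ σ' h₁ => exact .tauR _ _ _ _ _ _ (h₁.append K)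

theorem FRed.change_hist {δ γ : Hist} {ρ σ : Option RC} {d : Conf}
    (hr : FRed ⟨δ, ρ, γ, σ⟩ d) (H K : Hist) : ∃ d', FRed ⟨H, ρ, K, σ⟩ d' := by
  cases hr with
  | comm δ δ' γ γ' ρ ρ' σ σ' p a h₁ h₂ =>
    obtain ⟨_, h₁⟩ := h₁.change_hist (by simp) H
    obtain ⟨_, h₂⟩ := h₂.change_hist (by simp) K
    exact ⟨_, .comm _ _ _ _ _ _ _ _ p a h₁ h₂⟩
  | tauL δ δ' γ ρ ρ' σ h₁ =>
    obtain ⟨_, h₁⟩ := h₁.change_hist (by simp) H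
    exact ⟨_, .tauL _ _ _ _ _ _ h₁⟩
  | tauR δ γ γ' ρ σ σ' h₁ =>
    obtain ⟨_, h₁⟩ := h₁.change_hist (by simp) K
    exact ⟨_, .tauR _ _ _ _ _ _ h₁⟩

theorem Red.addHist {c c' : Conf} (hr : Red c c') (H K : Hist) :
    Red (c.addHist H K) (c'.addHist H K) := by
  cases hr with
  | fwd _ _ hf => exact .fwd _ _ (hf.addHist H K)
  | rbk δ δ' γ γ' ρ ρ' σ σ' hne hn h₁ h₂ =>
    refine .rbk _ _ _ _ _ _ _ _ hne (fun d hd => ?_) (h₁.append H) (h₂.append K)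
    obtain ⟨d', hd'⟩ := hd.change_hist δ γ
    exact hn d' hd'

theorem Reds.addHist {c c' : Conf} (hr : Reds c c') (H K : Hist) :
    Reds (c.addHist H K) (c'.addHist H K) :=
  Relation.ReflTransGen.lift (fun c : Conf => c.addHist H K) (fun _ _ h => Red.addHist h H K) _ _ hr

theorem Red.length_eq {c c' : Conf} (hr : Red c c') (hl : c.cH.length = c.sH.length) :
    c'.cH.length = c'.sH.length := by
  cases hr with
  | fwd _ _ hf =>
    cases hf with
    | comm δ δ' γ γ' ρ ρ' σ σ' p a h₁ h₂ =>
      have e₁ := h₁.length_hist.1 _ _ rfl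
      have e₂ := h₂.length_hist.1 _ _ rfl
      simp only at hl ⊢
      omega
    | tauL δ δ' γ ρ ρ' σ h₁ =>
      have e₁ := h₁.length_hist.2.1 rfl
      simp only at hl ⊢
      omega
    | tauR δ γ γ' ρ σ σ' h₁ =>
      have e₁ := h₁.length_hist.2.1 rfl
      simp only at hl ⊢
      omega
  | rbk δ δ' γ γ' ρ ρ' σ σ' hne hn h₁ h₂ =>
    have e₁ := h₁.length_hist.2.2 rfl
    have e₂ := h₂.length_hist.2.2 rfl
    simp only at hl ⊢
    omega

theorem Reds.length_eq {c c' : Conf} (hr : Reds c c') (hl : c.cH.length = c.sH.length) :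
    c'.cH.length = c'.sH.length := by
  induction hr with
  | refl => exact hl
  | tail _ h ih => exact h.length_eq ih

theorem Stuck.not_fRed {c : Conf} (hs : Stuck c) (d : Conf) : ¬ FRed c d :=
  fun hd => hs d (.fwd _ _ hd)

theorem Stuck.hist_eq_nil {c : Conf} (hs : Stuck c) (hc : c.c ≠ some .one)
    (hl : c.cH.length = c.sH.length) : c.cH = [] ∧ c.sH = [] := by
  obtain ⟨δ, ρ, γ, σ⟩ := c
  cases δ with
  | nil => exact ⟨rfl, List.length_eq_zero_iff.1 hl.symm⟩
  | cons x δ =>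
    cases γ with
    | nil => simp at hl
    | cons y γ => exact absurd (.rbk _ _ _ _ _ _ _ _ hc hs.not_fRed (.rb _ _ _) (.rb _ _ _)) (hs _)

/-- Non-compliant contracts can run until their alternatives are restored. -/
theorem reds_rollback_of_not_compliant {ρ σ : RC} (hn : ¬ Compliant ρ σ) (R S : Option RC) :
    Reds ⟨[R], some ρ, [S], some σ⟩ ⟨[], R, [], S⟩ := by
  unfold Compliant CompliantCH at hn
  push Not at hn
  obtain ⟨c, hr, hs, hc⟩ := hn
  obtain ⟨h₁, h₂⟩ := hs.hist_eq_nil hc (hr.length_eq rfl)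
  obtain ⟨δ, ρ', γ, σ'⟩ := c
  simp only at h₁ h₂ hc
  subst h₁ h₂
  refine Relation.ReflTransGen.tail (hr.addHist [R] [S])
    (.rbk _ _ _ _ _ _ _ _ hc (fun d hd => ?_) (.rb _ _ _) (.rb _ _ _))
  obtain ⟨d', hd'⟩ := hd.change_hist [] []
  exact hs.not_fRed d' hd'

theorem restOf_of_ne_nil {l : List (ℕ × RC)} (hl : l ≠ []) (p : Bool) :
    restOf p l = some (.ext p l) := by
  cases l with
  | nil => exact absurd rfl hl
  | cons x l => rfl

theorem restOf_ne_one (p : Bool) (l : List (ℕ × RC)) : restOf p l ≠ some .one := by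
  cases l <;> simp [restOf]

/-- The branches of `l` whose name is not offered by `m`. -/
abbrev unmatched (l m : List (ℕ × RC)) : List (ℕ × RC) :=
  l.filter fun x => decide (x.1 ∉ m.map Prod.fst)

theorem unmatched_remove {l₁ l₂ m₁ m₂ : List (ℕ × RC)} {a : ℕ} {r s : RC}
    (hl : ((l₁ ++ (a, r) :: l₂).map Prod.fst).Nodup) :
    unmatched (l₁ ++ (a, r) :: l₂) (m₁ ++ (a, s) :: m₂) = unmatched (l₁ ++ l₂) (m₁ ++ m₂) := by
  have hne : ∀ x ∈ l₁ ++ l₂, x.1 ≠ a := by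
    rintro ⟨b, t⟩ hx rfl
    rw [List.map_append, List.map_cons, List.nodup_middle, List.nodup_cons,
      ← List.map_append] at hl
    exact hl.1 (List.mem_map.2 ⟨_, hx, rfl⟩)
  have hdrop : unmatched (l₁ ++ (a, r) :: l₂) (m₁ ++ (a, s) :: m₂) =
      unmatched (l₁ ++ l₂) (m₁ ++ (a, s) :: m₂) := by
    simp [unmatched]
  rw [hdrop]
  refine List.filter_congr fun x hx => ?_
  have := hne x hx
  simp [this]

theorem reds_restOf_unmatched (p : Bool) : ∀ (n : ℕ) (lρ lσ : List (ℕ × RC)), lρ.length = n →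
    (lρ.map Prod.fst).Nodup → (lσ.map Prod.fst).Nodup →
    (∀ (a : ℕ) (ρk σk : RC), (a, ρk) ∈ lρ → (a, σk) ∈ lσ → ¬ Compliant ρk σk) →
    Reds ⟨[], restOf p lρ, [], restOf (!p) lσ⟩
      ⟨[], restOf p (unmatched lρ lσ), [], restOf (!p) (unmatched lσ lρ)⟩ := by
  intro n
  induction n with
  | zero =>
    intro lρ lσ hn _ _ _
    obtain rfl := List.length_eq_zero_iff.1 hn
    simp only [unmatched, List.filter_nil, List.map_nil, List.not_mem_nil, not_false_eq_true,
      decide_true, List.filter_true]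
    exact Relation.ReflTransGen.refl
  | succ n ih =>
    intro lρ lσ hn hρ hσ h
    by_cases hm : ∃ a r s, (a, r) ∈ lρ ∧ (a, s) ∈ lσ
    · obtain ⟨a, r, s, hr, hs⟩ := hm
      have hc := h a r s hr hs
      obtain ⟨l₁, l₂, rfl⟩ := List.append_of_mem hr
      obtain ⟨m₁, m₂, rfl⟩ := List.append_of_mem hs
      rw [unmatched_remove hρ, unmatched_remove hσ, restOf_of_ne_nil (by simp),
        restOf_of_ne_nil (by simp)]
      refine Relation.ReflTransGen.head
        (.fwd _ _ (.comm _ _ _ _ _ _ _ _ p a (.ext [] p l₁ l₂ a r) (.ext [] (!p) m₁ m₂ a s)))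
        ((reds_rollback_of_not_compliant hc _ _).trans ?_)
      have hsub : ∀ (k₁ k₂ : List (ℕ × RC)) (x : ℕ × RC),
          (k₁ ++ k₂).Sublist (k₁ ++ x :: k₂) :=
        fun k₁ k₂ x => (List.sublist_cons_self x k₂).append_left k₁
      refine ih _ _ ?_ (hρ.sublist ((hsub _ _ _).map _)) (hσ.sublist ((hsub _ _ _).map _))
        fun b t u ht hu => h b t u ((hsub _ _ _).subset ht) ((hsub _ _ _).subset hu)
      simp only [List.length_append, List.length_cons] at hn ⊢
      omega
    · push Not at hm
      have h₁ : unmatched lρ lσ = lρ := by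
        refine List.filter_eq_self.2 fun x hx => ?_
        simpa using fun s => hm x.1 x.2 s hx
      have h₂ : unmatched lσ lρ = lσ := by
        refine List.filter_eq_self.2 fun x hx => ?_
        simpa using fun r hr => hm x.1 r x.2 hr hx
      rw [h₁, h₂]
      exact Relation.ReflTransGen.refl

theorem Step.of_restOf {H δ : Hist} {p : Bool} {l : List (ℕ × RC)} {α : Act} {ρ : Option RC}
    (hs : Step H (restOf p l) α δ ρ) : α = .rb ∨ ∃ x ∈ l, α = .act p x.1 := by
  cases l with
  | nil => cases hs; exact .inl rfl
  | cons x l =>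
    generalize hc : restOf p (x :: l) = c at hs
    rw [restOf_of_ne_nil (by simp)] at hc
    cases hs with
    | ext γ p' l₁ l₂ a σ =>
      simp only [Option.some.injEq, RC.ext.injEq] at hc
      refine .inr ⟨(a, σ), ?_, by rw [hc.1]⟩
      rw [hc.2]
      simp
    | rb => exact .inl rfl
    | _ => simp at hc

theorem stuck_restOf {p q : Bool} {l m : List (ℕ × RC)}
    (hd : ∀ x ∈ l, ∀ y ∈ m, x.1 ≠ y.1) : Stuck ⟨[], restOf p l, [], restOf q m⟩ := by
  intro c hr
  cases hr with
  | fwd _ _ hf =>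
    cases hf with
    | comm δ δ' γ γ' ρ ρ' σ σ' p a h₁ h₂ =>
      obtain h | ⟨x, hx, ex⟩ := h₁.of_restOf
      · cases h
      obtain h | ⟨y, hy, ey⟩ := h₂.of_restOf
      · cases h
      simp only [Act.act.injEq] at ex ey
      exact hd x hx y hy (ex.2.symm.trans ey.2)
    | tauL δ δ' γ ρ ρ' σ h₁ => simpa using h₁.of_restOf
    | tauR δ γ γ' ρ σ σ' h₁ => simpa using h₁.of_restOf
  | rbk δ δ' γ γ' ρ ρ' σ σ' hne hn h₁ h₂ => simpa using h₁.length_hist.2.2 rfl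

/-- two dual retractable sums all of whose matching continuation
pairs fail to be compliant are not compliant: there is a reduction, trying and
rolling back each matching branch, ending in the stuck configuration formed by
the sums restricted to the unmatched names (`∘` if no branch remains), whose
client is different from `1`. -/
theorem retractable_sums_all_branches_fail (p : Bool) (lρ lσ : List (ℕ × RC))
    (hwfρ : WF (.ext p lρ)) (hwfσ : WF (.ext (!p) lσ))
    (h : ∀ (a : ℕ) (ρk σk : RC), (a, ρk) ∈ lρ → (a, σk) ∈ lσ →
          ¬ Compliant ρk σk) :
    ¬ Compliant (.ext p lρ) (.ext (!p) lσ) ∧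
    Reds ⟨[], some (.ext p lρ), [], some (.ext (!p) lσ)⟩
         ⟨[], restOf p (lρ.filter fun x => decide (x.1 ∉ lσ.map Prod.fst)),
          [], restOf (!p) (lσ.filter fun x => decide (x.1 ∉ lρ.map Prod.fst))⟩ ∧
    Stuck ⟨[], restOf p (lρ.filter fun x => decide (x.1 ∉ lσ.map Prod.fst)),
           [], restOf (!p) (lσ.filter fun x => decide (x.1 ∉ lρ.map Prod.fst))⟩ ∧
    restOf p (lρ.filter fun x => decide (x.1 ∉ lσ.map Prod.fst)) ≠ some RC.one := by
  have hρ : lρ ≠ [] ∧ (lρ.map Prod.fst).Nodup := by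
    cases hwfρ with
    | ext _ _ _ h₁ h₂ _ => exact ⟨h₁, h₂⟩
  have hσ : lσ ≠ [] ∧ (lσ.map Prod.fst).Nodup := by
    cases hwfσ with
    | ext _ _ _ h₁ h₂ _ => exact ⟨h₁, h₂⟩
  have hreds := reds_restOf_unmatched p _ lρ lσ rfl hρ.2 hσ.2 h
  rw [restOf_of_ne_nil hρ.1, restOf_of_ne_nil hσ.1] at hreds
  have hstuck : Stuck ⟨[], restOf p (unmatched lρ lσ), [], restOf (!p) (unmatched lσ lρ)⟩ := by
    refine stuck_restOf fun x hx y hy hxy => ?_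
    simp only [unmatched, List.mem_filter, decide_eq_true_eq] at hx hy
    exact hx.2 (hxy ▸ List.mem_map_of_mem hy.1)
  exact ⟨fun hc => restOf_ne_one _ _ (hc _ hreds hstuck), hreds, hstuck, restOf_ne_one _ _⟩
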